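/- Completeness of the rules R1 and R2 at the level of separation information: let G=(V,E) be a directed graph, possibly cyclic, whose node set is partitioned as V = O ∪ L into observed and latent nodes, with distinct observed nodes X,Y ∈ O satisfying the pre-treatment assumption (De(Y)=∅ and Ch(X) ⊆ {Y}). Suppose neither the R1 condition nor the R2 condition holds in G, where the R1 condition is: there exist W ∈ MB_σ^G(X)\{Y} and Z ⊆ MB_σ^G(Y)\{X,W} with W not σ-separated from Y given Z and W σ-separated from Y given Z ∪ {X}; and the R2 condition is: either there exists Z ⊆ MB_σ^G(Y)\{X} with X σ-separated from Y given Z, or there exist W ∈ MB_σ^G(X)\{Y} and Z ⊆ MB_σ^G(Y)\{X,W} with W not σ-separated from X given Z and W σ-separated from Y given Z. Then the σ-separation relations among the observed nodes O do not determine the presence of the edge X→Y: there exist two directed graphs G_1 and G_2, each with observed nodes O and satisfying the pre-treatment assumption for (X,Y), that induce exactly the same σ-separation relations among the observed nodes as G, such that X→Y is an edge of G_1 but not an edge of G_2. -/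

import Mathlib

/-- A directed graph (loopless, possibly cyclic). -/
structure DiGraph (V : Type) where
  Edge : V → V → Prop
  loopless : ∀ v, ¬ Edge v v

namespace DiGraph

variable {V : Type}

/-- Reachability by a directed path (possibly of length zero). -/
def reach (G : DiGraph V) : V → V → Prop := Relation.ReflTransGen G.Edge

/-- Ancestors of a set: nodes admitting a directed path (possibly of length zero)
to some node of the set. -/
def anc (G : DiGraph V) (S : Set V) : Set V := {Z | ∃ s ∈ S, G.reach Z s}

/-- The strongly connected component of a node. -/
def scc (G : DiGraph V) (X : V) : Set V := {Z | G.reach X Z ∧ G.reach Z X}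

/-- Descendants: nodes `Z ≠ X` with a directed path from `X` to `Z`. -/
def de (G : DiGraph V) (X : V) : Set V := {Z | Z ≠ X ∧ Relation.TransGen G.Edge X Z}

/-- Children of a node. -/
def ch (G : DiGraph V) (X : V) : Set V := {Z | G.Edge X Z}

/-- A directed graph is acyclic (a DAG) if it has no directed cycles. -/
def Acyclic (G : DiGraph V) : Prop := ∀ v, ¬ Relation.TransGen G.Edge v v

end DiGraph

/-- A path between `X` and `Y` in `G`: a sequence of `k+2` distinct nodes,
where consecutive nodes are joined by an edge of `G` in one of the two
orientations (recorded by `dir`: `dir i = true` means the edge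
`node i → node (i+1)` is used, `dir i = false` means `node (i+1) → node i`). -/
structure GPath {V : Type} (G : DiGraph V) (X Y : V) where
  k : ℕ
  node : Fin (k + 2) → V
  dir : Fin (k + 1) → Bool
  inj : Function.Injective node
  first : node 0 = X
  last : node (Fin.last (k + 1)) = Y
  adj : ∀ i : Fin (k + 1),
    (dir i = true → G.Edge (node i.castSucc) (node i.succ)) ∧
    (dir i = false → G.Edge (node i.succ) (node i.castSucc))

namespace GPath

variable {V : Type} {G : DiGraph V} {X Y : V}

/-- The `j`-th interior (non-endpoint) node of the path (position `j+1`). -/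
def inner (p : GPath G X Y) (j : Fin p.k) : V := p.node j.succ.castSucc

/-- The interior node at position `j+1` is a collider: both incident edges
of the path point into it. -/
def isCollider (p : GPath G X Y) (j : Fin p.k) : Prop :=
  p.dir j.castSucc = true ∧ p.dir j.succ = false

/-- The path is σ-blocked by `S`. -/
def sigmaBlocked (p : GPath G X Y) (S : Set V) : Prop :=
  ∃ j : Fin p.k,
    (p.isCollider j ∧ p.inner j ∉ G.anc S) ∨
    (¬ p.isCollider j ∧ p.inner j ∈ S ∧
      ((p.dir j.succ = true ∧ p.node j.succ.succ ∉ G.scc (p.inner j)) ∨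
       (p.dir j.castSucc = false ∧ p.node j.castSucc.castSucc ∉ G.scc (p.inner j))))

/-- The path is d-blocked by `S`. -/
def dBlocked (p : GPath G X Y) (S : Set V) : Prop :=
  ∃ j : Fin p.k,
    (p.isCollider j ∧ p.inner j ∉ G.anc S) ∨
    (¬ p.isCollider j ∧ p.inner j ∈ S)

end GPath

namespace DiGraph

variable {V : Type}

/-- `X` and `Y` are σ-separated given `S`: every path between them is σ-blocked. -/
def sigmaSep (G : DiGraph V) (X Y : V) (S : Set V) : Prop :=
  ∀ p : GPath G X Y, p.sigmaBlocked S

/-- `X` and `Y` are d-separated given `S`: every path between them is d-blocked. -/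
def dSep (G : DiGraph V) (X Y : V) (S : Set V) : Prop :=
  ∀ p : GPath G X Y, p.dBlocked S

end DiGraph

/-- `Ga` is a σ-acyclification of `G`. -/
def IsAcyclification {V : Type} (G Ga : DiGraph V) : Prop :=
  Ga.Acyclic ∧
  (∀ X Y : V, X ≠ Y → X ∉ G.scc Y → (Ga.Edge X Y ↔ ∃ W ∈ G.scc Y, G.Edge X W)) ∧
  (∀ X Y : V, X ≠ Y → X ∈ G.scc Y → Xor' (Ga.Edge X Y) (Ga.Edge Y X))

namespace DiGraph

variable {V : Type}

/-- `S` is the observed Markov blanket of `X` (w.r.t. σ-separation) given the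
observed node set `Obs`: the minimal set `S ⊆ Obs \ {X}` such that `X` is
σ-separated from every node of `Obs \ (S ∪ {X})` given `S`. -/
def IsSigmaMB (G : DiGraph V) (Obs : Set V) (X : V) (S : Set V) : Prop :=
  S ⊆ Obs \ {X} ∧
  (∀ W ∈ Obs \ (S ∪ {X}), G.sigmaSep X W S) ∧
  (∀ T ⊆ Obs \ {X}, (∀ W ∈ Obs \ (T ∪ {X}), G.sigmaSep X W T) → S ⊆ T)

/-- `S` is the observed Markov blanket of `X` (w.r.t. d-separation). -/
def IsDMB (G : DiGraph V) (Obs : Set V) (X : V) (S : Set V) : Prop :=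
  S ⊆ Obs \ {X} ∧
  (∀ W ∈ Obs \ (S ∪ {X}), G.dSep X W S) ∧
  (∀ T ⊆ Obs \ {X}, (∀ W ∈ Obs \ (T ∪ {X}), G.dSep X W T) → S ⊆ T)

/-- `Z` is a backdoor adjustment set for `(X, Y)`: `Z` avoids `X`, `Y` and the
descendants of `X`, and σ-blocks every backdoor path from `X` to `Y`
(a path whose first edge has an arrowhead into `X`). -/
def IsBackdoorAdjustment (G : DiGraph V) (X Y : V) (Z : Set V) : Prop :=
  X ∉ Z ∧ Y ∉ Z ∧ Z ∩ G.de X = ∅ ∧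
  ∀ p : GPath G X Y, p.dir 0 = false → p.sigmaBlocked Z

end DiGraph

/-- Pre-treatment assumption: the outcome `Y` has no descendants and the
treatment `X` has no children except possibly `Y`. -/
def PreTreatment {V : Type} (G : DiGraph V) (X Y : V) : Prop :=
  G.de Y = ∅ ∧ G.ch X ⊆ {Y}

namespace RC

variable {V : Type}

def ok (G : DiGraph V) (S : Set V) (u v : V) : Prop :=
  G.Edge u v ∧ (u ∈ S → v ∈ G.scc u)

def R (G : DiGraph V) (S : Set V) : V → V → Prop := Relation.ReflTransGen (ok G S)

def T (G : DiGraph V) (S : Set V) (a b : V) : Prop := ∃ t, R G S t a ∧ R G S t b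

inductive CC (G : DiGraph V) (S E : Set V) : V → V → Prop
  | base {a b : V} : T G S a b → CC G S E a b
  | cons {a s b : V} : T G S a s → s ∈ E → CC G S E s b → CC G S E a b

abbrev C (G : DiGraph V) (S : Set V) (a b : V) : Prop := CC G S S a b

variable {G : DiGraph V}

lemma ok_anti {S1 S2 : Set V} (h : S1 ⊆ S2) {u v : V} (h1 : ok G S2 u v) : ok G S1 u v :=
  ⟨h1.1, fun hu => h1.2 (h hu)⟩

lemma R_anti {S1 S2 : Set V} (h : S1 ⊆ S2) {u v : V} (h1 : R G S2 u v) : R G S1 u v :=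
  Relation.ReflTransGen.mono (r := ok G S2) (p := ok G S1) (fun _ _ => ok_anti h) _ _ h1

lemma R_refl {S : Set V} (u : V) : R G S u u := Relation.ReflTransGen.refl

lemma R_trans {S : Set V} {u v w : V} (h1 : R G S u v) (h2 : R G S v w) : R G S u w :=
  Relation.ReflTransGen.trans h1 h2

lemma R_reach {S : Set V} {u v : V} (h1 : R G S u v) : G.reach u v :=
  Relation.ReflTransGen.mono (r := ok G S) (p := G.Edge) (fun _ _ h => h.1) _ _ h1

lemma T_refl {S : Set V} (u : V) : T G S u u := ⟨u, R_refl u, R_refl u⟩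

lemma T_symm {S : Set V} {a b : V} (h : T G S a b) : T G S b a := by
  obtain ⟨t, h1, h2⟩ := h; exact ⟨t, h2, h1⟩

lemma T_anti {S1 S2 : Set V} (h : S1 ⊆ S2) {u v : V} (h1 : T G S2 u v) : T G S1 u v := by
  obtain ⟨t, h1, h2⟩ := h1; exact ⟨t, R_anti h h1, R_anti h h2⟩

lemma T_ext {S : Set V} {a b c : V} (h : T G S a b) (h' : R G S b c) : T G S a c := by
  obtain ⟨t, h1, h2⟩ := h; exact ⟨t, h1, R_trans h2 h'⟩

lemma CC_mono {S1 S2 E1 E2 : Set V} (h : S1 ⊆ S2) (hE : E1 ⊆ E2) {a b : V}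
    (h1 : CC G S2 E1 a b) : CC G S1 E2 a b := by
  induction h1 with
  | base h1 => exact .base (T_anti h h1)
  | cons h1 h2 _ ih => exact .cons (T_anti h h1) (hE h2) ih

lemma CC_trans {S E : Set V} {a s b : V} (h1 : CC G S E a s) (hs : s ∈ E) (h2 : CC G S E s b) :
    CC G S E a b := by
  induction h1 with
  | base h1 => exact .cons h1 hs h2
  | cons h1 h3 _ ih => exact .cons h1 h3 (ih hs h2)

lemma CC_symm {S E : Set V} {a b : V} (h1 : CC G S E a b) : CC G S E b a := by
  induction h1 with
  | base h1 => exact .base (T_symm h1)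
  | cons h1 h3 _ ih => exact CC_trans ih h3 (.base (T_symm h1))

lemma CC_ext {S E : Set V} {a b c : V} (h1 : CC G S E a b) (h : R G S b c) : CC G S E a c := by
  induction h1 with
  | base h1 => exact .base (T_ext h1 h)
  | cons h1 h3 _ ih => exact .cons h1 h3 (ih h)

lemma R_first {Z S : Set V} {u v : V} (h : R G Z u v) :
    R G S u v ∨ ∃ n ∈ S \ Z, R G S u n := by
  induction h using Relation.ReflTransGen.head_induction_on with
  | refl => exact .inl (R_refl _)
  | @head a c h1 h2 ih =>
    by_cases hk : ok G S a c
    · rcases ih with ih | ⟨n, hn, ih⟩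
      · exact .inl (Relation.ReflTransGen.head hk ih)
      · exact .inr ⟨n, hn, Relation.ReflTransGen.head hk ih⟩
    · right
      refine ⟨a, ⟨?_, ?_⟩, R_refl _⟩
      · by_contra ha; exact hk ⟨h1.1, fun h => absurd h ha⟩
      · intro ha; exact hk ⟨h1.1, fun _ => h1.2 ha⟩

lemma R_last {Z S : Set V} {u v : V} (h : R G Z u v) :
    R G S u v ∨ ∃ n ∈ S \ Z, R G (S \ {n}) n v := by
  induction h using Relation.ReflTransGen.head_induction_on with
  | refl => exact .inl (R_refl _)
  | @head a c h1 h2 ih =>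
    rcases ih with ih | ih
    · by_cases hk : ok G S a c
      · exact .inl (Relation.ReflTransGen.head hk ih)
      · right
        refine ⟨a, ⟨?_, ?_⟩, Relation.ReflTransGen.head ⟨h1.1, fun h => absurd rfl h.2⟩
          (R_anti Set.sdiff_subset ih)⟩
        · by_contra ha; exact hk ⟨h1.1, fun h => absurd h ha⟩
        · intro ha; exact hk ⟨h1.1, fun _ => h1.2 ha⟩
    · exact .inr ih

lemma reach_R {S : Set V} {u v : V} (h : G.reach u v) :
    R G S u v ∨ ∃ n ∈ S, R G S u n := by
  have h' : R G ∅ u v := Relation.ReflTransGen.mono (r := G.Edge) (p := ok G ∅) (fun _ _ h => ⟨h, fun h => absurd h (by simp)⟩) _ _ h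
  rcases R_first (S := S) h' with h | ⟨n, hn, h⟩
  · exact .inl h
  · exact .inr ⟨n, hn.1, h⟩

lemma T_split {Z S : Set V} {a b : V} (h : T G Z a b) :
    T G S a b ∨ ∃ n ∈ S \ Z, T G (S \ {n}) n b := by
  obtain ⟨t, ha, hb⟩ := h
  rcases R_last (S := S) hb with hb | ⟨n, hn, hb⟩
  · rcases R_first (S := S) ha with ha | ⟨n, hn, ha⟩
    · exact .inl ⟨t, ha, hb⟩
    · exact .inr ⟨n, hn, t, R_anti Set.sdiff_subset ha, R_anti Set.sdiff_subset hb⟩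
  · exact .inr ⟨n, hn, n, R_refl _, hb⟩

lemma C_comp {Z S : Set V} (hZ : Z ⊆ S) {a y : V} (h : C G S a y) :
    C G Z a y ∨ ∃ n ∈ S \ Z, C G Z n y := by
  induction h with
  | base h => exact .inl (.base (T_anti hZ h))
  | @cons a s b h1 h2 _ ih =>
    rcases ih with ih | ih
    · by_cases hs : s ∈ Z
      · exact .inl (.cons (T_anti hZ h1) hs ih)
      · exact .inr ⟨s, ⟨h2, hs⟩, ih⟩
    · exact .inr ih

lemma C_int {Z S : Set V} (hZ : Z ⊆ S) {a y : V} (h : C G Z a y) :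
    C G S a y ∨ ∃ n ∈ S \ Z, C G (S \ {n}) n y := by
  induction h with
  | base h =>
    rcases T_split (S := S) h with h | ⟨n, hn, h⟩
    · exact .inl (.base h)
    · exact .inr ⟨n, hn, .base h⟩
  | @cons a s b h1 h2 _ ih =>
    rcases ih with ih | ih
    · rcases T_split (S := S) h1 with h | ⟨n, hn, h⟩
      · exact .inl (.cons h (hZ h2) ih)
      · refine .inr ⟨n, hn, ?_⟩
        have hsn : s ∈ S \ {n} := ⟨hZ h2, fun h => hn.2 (by rw [← Set.mem_singleton_iff.1 h]; exact h2)⟩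
        rcases C_comp (Z := S \ {n}) Set.sdiff_subset ih with h' | ⟨m, hm, h'⟩
        · exact .cons h hsn h'
        · have : m = n := by
            by_contra hne; exact hm.2 ⟨hm.1, hne⟩
          exact this ▸ h'
    · exact .inr ih

lemma comp1 {S : Set V} {a D y : V} (h : C G (insert D S) a y) : C G S a y ∨ C G S D y := by
  rcases C_comp (Set.subset_insert D S) h with h | ⟨n, hn, h1⟩
  · exact .inl h
  · rcases hn.1 with rfl | h'
    · exact .inr h1
    · exact absurd h' hn.2

lemma self1 {S : Set V} {a y : V} (h : C G (insert a S) a y) : C G S a y := by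
  rcases comp1 h with h | h <;> exact h

lemma contr1 {S : Set V} {a D y : V} (h : C G S a y) : C G (insert D S) a y ∨ C G S D y := by
  rcases C_int (Set.subset_insert D S) h with h | ⟨n, hn, h⟩
  · exact .inl h
  · rcases hn.1 with rfl | h'
    · right
      rwa [Set.insert_sdiff_self_of_notMem hn.2] at h
    · exact absurd h' hn.2

lemma inter1 {S : Set V} {A D y : V} (hA : A ∉ S) (hD : D ∉ S) (hAD : A ≠ D) (h : C G S A y) :
    C G (insert D S) A y ∨ C G (insert A S) D y := by
  have hs : S ⊆ insert A (insert D S) := fun x hx => .inr (.inr hx)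
  rcases C_int hs h with h | ⟨n, hn, h⟩
  · exact .inl (self1 h)
  · rcases hn.1 with rfl | rfl | h'
    · left; rwa [Set.insert_sdiff_self_of_notMem] at h
      simp [hAD, hA]
    · right; rw [Set.insert_comm, Set.insert_sdiff_self_of_notMem] at h
      · exact h
      · simp [hAD.symm, hD]
    · exact absurd h' hn.2

lemma R_up {S1 S2 : Set V} {t v : V} (h : ∀ w ∈ S2, w ∉ S1 → G.reach w v → G.reach v w)
    (h1 : R G S1 t v) : R G S2 t v := by
  induction h1 using Relation.ReflTransGen.head_induction_on with
  | refl => exact R_refl _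
  | @head a c h1 h2 ih =>
    refine Relation.ReflTransGen.head ⟨h1.1, fun ha => ?_⟩ ih
    by_cases ha1 : a ∈ S1
    · exact h1.2 ha1
    · have hcv := R_reach h2
      have hac : G.reach a c := Relation.ReflTransGen.single h1.1
      exact ⟨hac, hcv.trans (h a ha ha1 (hac.trans hcv))⟩

def Pu (G : DiGraph V) (S1 S2 : Set V) (v : V) : Prop :=
  ∀ w ∈ S2, w ∉ S1 → G.reach w v → G.reach v w

lemma C_up {S1 S2 : Set V} (hS : S1 ⊆ S2) {a b : V} (hs : ∀ s ∈ S1, Pu G S1 S2 s)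
    (ha : Pu G S1 S2 a) (hb : Pu G S1 S2 b) (h : C G S1 a b) : C G S2 a b := by
  induction h with
  | base h => obtain ⟨t, h1, h2⟩ := h; exact .base ⟨t, R_up ha h1, R_up hb h2⟩
  | cons h h1 _ ih =>
    obtain ⟨t, h2, h3⟩ := h
    exact .cons ⟨t, R_up ha h2, R_up (hs _ h1) h3⟩ (hS h1) (ih (hs _ h1) hb)

lemma last_swap {S M : Set V} {A x : V} (hA : A ∉ S) (h : C G S A x) :
    ∃ v ∈ insert A (S \ M),
      CC G (insert A S \ {v}) ((insert A S \ {v}) ∩ M) v x := by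
  have key : ∀ b, C G S b x → (∃ v ∈ insert A (S \ M),
      CC G (insert A S \ {v}) ((insert A S \ {v}) ∩ M) v x) ∨ CC G (insert A S) (S ∩ M) b x := by
    intro b hb
    induction hb with
    | base h0 =>
      rcases T_split (S := insert A S) h0 with h | ⟨n, hn, h⟩
      · exact .inr (.base h)
      · have : n = A := hn.1.resolve_right hn.2
        subst this
        exact .inl ⟨n, .inl rfl, .base h⟩
    | @cons a s b h1 h2 _ ih =>
      rcases ih h with ih | ih
      · exact .inl ih
      · by_cases hs : s ∈ M
        · rcases T_split (S := insert A S) h1 with h | ⟨n, hn, h⟩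
          · exact .inr (.cons h ⟨h2, hs⟩ ih)
          · have : n = A := hn.1.resolve_right hn.2
            subst this
            refine .inl ⟨n, .inl rfl, .cons h ⟨⟨.inr h2, ?_⟩, hs⟩ (CC_mono Set.sdiff_subset ?_ ih)⟩
            · rintro rfl; exact hn.2 h2
            · rintro y ⟨hy, hy'⟩
              refine ⟨⟨.inr hy, ?_⟩, hy'⟩
              rintro rfl; exact hn.2 hy
        · refine .inl ⟨s, .inr ⟨h2, hs⟩, CC_mono Set.sdiff_subset ?_ ih⟩
          rintro y ⟨hy, hy'⟩
          refine ⟨⟨.inr hy, ?_⟩, hy'⟩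
          rintro rfl; exact hs hy'
  rcases key A h with h | h
  · exact h
  · refine ⟨A, .inl rfl, CC_mono Set.sdiff_subset ?_ h⟩
    rintro y ⟨hy, hy'⟩
    refine ⟨⟨.inr hy, ?_⟩, hy'⟩
    rintro rfl; exact hA hy

lemma D_not_anc {S : Set V} {A D Y : V} (h1 : C G S A D) (h2 : C G S D Y) (h3 : ¬ C G S A Y) :
    ∀ v, (v ∈ S ∨ v = A ∨ v = Y) → ¬ G.reach D v := by
  intro v hv hr
  have hs : ∀ s ∈ S, ¬ R G S D s := fun s hs hr =>
    h3 (CC_trans (CC_ext h1 hr) hs (CC_symm (CC_ext (CC_symm h2) hr)))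
  rcases reach_R (S := S) hr with hr | ⟨s, hs', hr⟩
  · rcases hv with hv | rfl | rfl
    · exact hs _ hv hr
    · exact h3 (CC_symm (CC_ext (CC_symm h2) hr))
    · exact h3 (CC_ext h1 hr)
  · exact hs _ hs' hr

lemma zy {Obs S M : Set V} {A Y : V} (hS : S ⊆ Obs) (hAO : A ∈ Obs) (hAS : A ∉ S) (hAY : A ≠ Y)
    (hYS : Y ∉ S) (hn : ¬ C G S A Y)
    (hD : ∀ D ∈ Obs, D ∉ S → D ≠ A → D ≠ Y → ∀ v, (v ∈ S ∨ v = A ∨ v = Y) → ¬ G.reach D v)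
    (hM : ∀ s ∈ Obs, s ≠ Y → C G (Obs \ {s, Y}) s Y → s ∈ M)
    {s : V} (hs : s ∈ S) (h : C G (S \ {s}) s Y) : s ∈ M := by
  have hsA : s ≠ A := fun e => hAS (e ▸ hs)
  have hsY : s ≠ Y := fun e => hYS (e ▸ hs)
  refine hM s (hS hs) hsY ?_
  have h1 : C G (insert A (S \ {s})) s Y := by
    rcases inter1 (D := A) (by simp) (by simp [hAS]) hsA h with h | h
    · exact h
    · rw [Set.insert_sdiff_singleton, Set.insert_eq_of_mem hs] at h
      exact absurd h hn
  have hP : ∀ v, (v ∈ S ∨ v = A ∨ v = Y) →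
      Pu G (insert A (S \ {s})) (Obs \ {s, Y}) v := by
    intro v hv w hw hw' hr
    simp only [Set.mem_sdiff, Set.mem_insert_iff, Set.mem_singleton_iff, not_or, not_and, not_not] at hw hw'
    exact absurd hr (hD w hw.1 (fun h => hw.2.1 (hw'.2 h)) hw'.1 hw.2.2 v hv)
  refine C_up ?_ ?_ (hP s (.inl hs)) (hP Y (.inr (.inr rfl))) h1
  · rintro v (rfl | ⟨hv, hv'⟩)
    · exact ⟨hAO, by simp [hAY, hsA.symm]⟩
    · refine ⟨hS hv, ?_⟩
      rintro (rfl | rfl)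
      · exact hv' rfl
      · exact hYS hv
  · rintro v (rfl | ⟨hv, hv'⟩)
    · exact hP _ (.inr (.inl rfl))
    · exact hP _ (.inl hv)

lemma zy2 {Obs S M Z : Set V} {A Y : V} (hS : S ⊆ Obs) (hAO : A ∈ Obs) (hAS : A ∉ S) (hAY : A ≠ Y)
    (hYS : Y ∉ S) (hn : ¬ C G S A Y)
    (hD : ∀ D ∈ Obs, D ∉ S → D ≠ A → D ≠ Y → ∀ v, (v ∈ S ∨ v = A ∨ v = Y) → ¬ G.reach D v)
    (hM : ∀ s ∈ Obs, s ≠ Y → C G (Obs \ {s, Y}) s Y → s ∈ M)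
    (hZ : Z ⊆ S) (hZM : ∀ n ∈ S, n ∉ Z → n ∉ M) : ¬ C G Z A Y := by
  intro h
  rcases C_int hZ h with h | ⟨n, hn', h⟩
  · exact hn h
  · exact hZM n hn'.1 hn'.2 (zy hS hAO hAS hAY hYS hn hD hM hn'.1 h)

lemma p0 [Finite V] {Obs M : Set V} {X Y : V} (hXO : X ∈ Obs) (hXY : X ≠ Y)
    (hM : ∀ s ∈ Obs, s ≠ Y → C G (Obs \ {s, Y}) s Y → s ∈ M)
    (hR : ∀ Z ⊆ M \ {X}, Z ⊆ Obs → Y ∉ Z → C G Z X Y) :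
    ∀ S ⊆ Obs, X ∉ S → Y ∉ S → C G S X Y := by
  by_contra hcon
  push Not at hcon
  obtain ⟨S0, h0⟩ := hcon
  obtain ⟨S, ⟨hSO, hXS, hYS, hn⟩, hmax⟩ := Set.exists_max_image
    {S : Set V | S ⊆ Obs ∧ X ∉ S ∧ Y ∉ S ∧ ¬ C G S X Y} (fun S => S.ncard) (Set.toFinite _)
    ⟨S0, h0⟩
  have hD : ∀ D ∈ Obs, D ∉ S → D ≠ X → D ≠ Y → ∀ v, (v ∈ S ∨ v = X ∨ v = Y) → ¬ G.reach D v := by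
    intro D hDO hDS hDX hDY
    have h1 : C G (insert D S) X Y := by
      by_contra h1
      have := hmax (insert D S) ⟨Set.insert_subset hDO hSO, by simp [hXS, hDX.symm],
        by simp [hYS, hDY.symm], h1⟩
      simp only [Set.ncard_insert_of_notMem hDS] at this
      omega
    have h2 := (comp1 h1).resolve_left hn
    have h3 := (comp1 (CC_symm h1)).resolve_left (fun h => hn (CC_symm h))
    exact D_not_anc (CC_symm h3) h2 hn
  refine zy2 (Z := S ∩ M) hSO hXO hXS hXY hYS hn hD hM Set.inter_subset_left
    (fun n h1 h2 h3 => h2 ⟨h1, h3⟩) (hR _ ?_ ?_ ?_)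
  · rintro v ⟨h1, h2⟩
    exact ⟨h2, fun e => hXS (by rw [← Set.mem_singleton_iff.1 e]; exact h1)⟩
  · exact fun v h => hSO h.1
  · exact fun h => hYS h.1

/-- counterexamples -/
def CE (G : DiGraph V) (Obs K : Set V) (X Y : V) : Set (V × Set V) :=
  {p | p.1 ∈ Obs ∧ p.1 ≠ X ∧ p.1 ≠ Y ∧ p.2 ⊆ Obs ∧ X ∉ p.2 ∧ Y ∉ p.2 ∧ p.1 ∉ p.2 ∧
    C G p.2 p.1 X ∧ ¬ C G (p.2 ∪ K) p.1 Y}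

lemma sink_reach {x v : V} (hx : ∀ v, ¬ G.Edge x v) (h : G.reach x v) : v = x := by
  induction h with
  | refl => rfl
  | tail h1 h2 ih => subst ih; exact absurd h2 (hx _)

lemma ce_conn [Finite V] {Obs K : Set V} {X Y : V} 
    (hK : (K = ∅ ∧ ∀ v, ¬ G.Edge X v) ∨ K = {X}) {A : V} {S : Set V} (hA : (A, S) ∈ CE G Obs K X Y)
    (hXY : X ≠ Y)
    (hmax : ∀ p ∈ CE G Obs K X Y, p.2.ncard ≤ S.ncard) :
    ∀ D ∈ Obs, D ∉ S → D ≠ A → D ≠ X → D ≠ Y → C G (S ∪ K) A D ∧ C G (S ∪ K) D Y := by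
  obtain ⟨hAO, hAX, hAY, hSO, hXS, hYS, hAS, hc, hn⟩ := hA
  dsimp only at *
  intro D hDO hDS' hDA hDX hDY
  have no1 : ¬ (C G (insert D S) A X ∧ ¬ C G (insert D S ∪ K) A Y) := by
    rintro ⟨h1, h2⟩
    have := hmax (A, insert D S) ⟨hAO, hAX, hAY, Set.insert_subset hDO hSO, by simp [hXS, Ne.symm hDX],
      by simp [hYS, hDY.symm], by simp [hAS, hDA.symm], h1, h2⟩
    simp only [Set.ncard_insert_of_notMem hDS'] at this
    omega
  have no2 : ¬ (C G (insert A S) D X ∧ ¬ C G (insert A S ∪ K) D Y) := by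
    rintro ⟨h1, h2⟩
    have := hmax (D, insert A S) ⟨hDO, hDX, hDY, Set.insert_subset hAO hSO, by simp [hXS, Ne.symm hAX],
      by simp [hYS, hAY.symm], by simp [hDS', hDA], h1, h2⟩
    simp only [Set.ncard_insert_of_notMem hAS] at this
    omega
  simp only [Set.insert_union] at no1 no2
  have hDYc : C G (S ∪ K) D Y := by
    by_contra hDYc
    rcases inter1 hAS hDS' hDA.symm hc with h | h
    · exact no1 ⟨h, fun h => (comp1 h).elim hn hDYc⟩
    · exact no2 ⟨h, fun h => (comp1 h).elim hDYc hn⟩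
  have hADc : C G (S ∪ K) A D := by
    by_contra hADc
    refine no1 ⟨?_, fun h => (comp1 (CC_symm h)).elim (fun h => hn (CC_symm h))
      (fun h => hADc (CC_symm h))⟩
    rcases hK with ⟨rfl, hK⟩ | rfl
    · rw [Set.union_empty] at *
      rcases contr1 (D := D) (CC_symm hc) with h | h
      · exact CC_symm h
      · exact absurd (CC_symm h) hADc
    · rcases inter1 hXS hDS' (Ne.symm hDX) (CC_symm hc) with h | h
      · exact CC_symm h
      · rw [Set.union_singleton] at hADc
        exact absurd (CC_symm h) hADc
  exact ⟨hADc, hDYc⟩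

lemma ce_D [Finite V] {Obs K : Set V} {X Y : V} 
    (hK : (K = ∅ ∧ ∀ v, ¬ G.Edge X v) ∨ K = {X}) {A : V} {S : Set V} (hA : (A, S) ∈ CE G Obs K X Y)
    (hXY : X ≠ Y)
    (hmax : ∀ p ∈ CE G Obs K X Y, p.2.ncard ≤ S.ncard) :
    ∀ D ∈ Obs, D ∉ S ∪ K → D ≠ A → D ≠ Y → ∀ v, (v ∈ S ∪ K ∨ v = A ∨ v = Y) → ¬ G.reach D v := by
  have hcn := ce_conn hK hA hXY hmax
  obtain ⟨hAO, hAX, hAY, hSO, hXS, hYS, hAS, hc, hn⟩ := hA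
  dsimp only at *
  intro D hDO hDS hDA hDY
  have hDS' : D ∉ S := fun h => hDS (.inl h)
  by_cases hDX : D = X
  · subst hDX
    rcases hK with ⟨rfl, hK⟩ | rfl
    · intro v hv hr
      have := sink_reach hK hr
      subst this
      rcases hv with hv | hv | hv
      · exact hDS hv
      · exact hDA hv
      · exact hDY hv
    · exact absurd (Or.inr rfl) hDS
  obtain ⟨h1, h2⟩ := hcn D hDO hDS' hDA hDX hDY
  exact D_not_anc h1 h2 hn

lemma key [Finite V] {Obs K M MX : Set V} {X Y : V} (hXO : X ∈ Obs) (hYO : Y ∈ Obs) (hXY : X ≠ Y)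
    (hY : ∀ v, ¬ G.Edge Y v)
    (hK : (K = ∅ ∧ (∀ v, ¬ G.Edge X v) ∧ ∀ S ⊆ Obs, X ∉ S → Y ∉ S → C G S X Y) ∨ K = {X})
    (hM : ∀ s ∈ Obs, s ≠ Y → C G (Obs \ {s, Y}) s Y → s ∈ M)
    (hMX : ∀ s ∈ Obs, s ≠ X → C G (Obs \ {s, X}) s X → s ∈ MX)
    (hR : ∀ W ∈ Obs, W ∈ MX → W ≠ X → W ≠ Y → ∀ Z ⊆ M, Z ⊆ Obs → X ∉ Z → Y ∉ Z → W ∉ Z →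
      C G Z W X → C G (Z ∪ K) W Y) :
    ∀ A ∈ Obs, A ≠ X → A ≠ Y → ∀ S ⊆ Obs, X ∉ S → Y ∉ S → A ∉ S → C G S A X →
      C G (S ∪ K) A Y := by
  by_contra hcon
  push Not at hcon
  obtain ⟨A0, a1, a2, a3, S0, a4, a5, a6, a7, a8, a9⟩ := hcon
  obtain ⟨⟨A, S⟩, hA, hmax⟩ := Set.exists_max_image (CE G Obs K X Y) (fun p => p.2.ncard)
    (Set.toFinite _) ⟨(A0, S0), ⟨a1, a2, a3, a4, a5, a6, a7, a8, a9⟩⟩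
  dsimp only at hmax
  have hK' : (K = ∅ ∧ ∀ v, ¬ G.Edge X v) ∨ K = {X} := hK.imp_left fun h => ⟨h.1, h.2.1⟩
  have hKO : K ⊆ Obs := by
    rcases hK' with ⟨rfl, -⟩ | rfl
    · simp
    · simpa using hXO
  have hKY : Y ∉ K := by
    rcases hK' with ⟨rfl, -⟩ | rfl
    · simp
    · simpa using hXY.symm
  have hKX : ∀ v ∈ K, v = X := by
    rcases hK' with ⟨rfl, -⟩ | rfl
    · simp
    · simp
  -- swap
  obtain ⟨A, S, hA, hmax, hZX⟩ : ∃ A S, (A, S) ∈ CE G Obs K X Y ∧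
      (∀ p ∈ CE G Obs K X Y, p.2.ncard ≤ S.ncard) ∧ C G (S ∩ M) A X := by
    have hD := ce_D hK' hA hXY hmax
    obtain ⟨hAO, hAX, hAY, hSO, hXS, hYS, hAS, hc, hn⟩ := hA
    dsimp only at *
    obtain ⟨v, hv, hcc⟩ := last_swap (M := M) hAS hc
    rcases hv with rfl | ⟨hvS, hvM⟩
    · rw [Set.insert_sdiff_self_of_notMem hAS] at hcc
      exact ⟨v, S, ⟨hAO, hAX, hAY, hSO, hXS, hYS, hAS, hc, hn⟩, hmax,
        CC_mono Set.inter_subset_left subset_rfl hcc⟩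
    · have hvX : v ≠ X := fun e => hXS (e ▸ hvS)
      have hvA : v ≠ A := fun e => hAS (e ▸ hvS)
      have hvK : v ∉ K := fun h => hvX (hKX v h)
      have hAK : A ∉ K := fun h => hAX (hKX A h)
      refine ⟨v, insert A S \ {v}, ⟨hSO hvS, hvX, fun e => hYS (e ▸ hvS), ?_, ?_, ?_, by simp, ?_, ?_⟩,
        ?_, CC_mono Set.inter_subset_left subset_rfl hcc⟩
      · exact Set.sdiff_subset.trans (Set.insert_subset hAO hSO)
      · simp [hXS, hAX.symm]
      · simp [hYS, hAY.symm]
      · exact CC_mono subset_rfl Set.inter_subset_left hcc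
      · have e : insert A S \ {v} ∪ K = insert A ((S ∪ K) \ {v}) := by
          ext w
          simp only [Set.mem_union, Set.mem_sdiff, Set.mem_insert_iff, Set.mem_singleton_iff]
          constructor
          · rintro (⟨h | h, h'⟩ | h)
            · exact .inl h
            · exact .inr ⟨.inl h, h'⟩
            · exact .inr ⟨.inr h, fun e => hvK (e ▸ h)⟩
          · rintro (h | ⟨h | h, h'⟩)
            · exact .inl ⟨.inl h, fun e => hvA (e ▸ h)⟩
            · exact .inl ⟨.inr h, h'⟩
            · exact .inr h
        have hvn : ¬ C G ((S ∪ K) \ {v}) v Y := fun h => hvM <|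
          zy (Set.union_subset hSO hKO) hAO (by simp [hAS, hAK]) hAY (by simp [hYS, hKY]) hn hD hM
            (.inl hvS) h
        dsimp only
        rw [e]
        intro h
        rcases comp1 h with h | h
        · exact hvn h
        · rcases contr1 (D := v) h with h | h
          · rw [Set.insert_sdiff_singleton, Set.insert_eq_of_mem (.inl hvS)] at h
            exact hn h
          · exact hvn h
      · rw [Set.ncard_sdiff_singleton_of_mem (.inr hvS), Set.ncard_insert_of_notMem hAS]
        simpa using hmax
  have hD := ce_D hK' hA hXY hmax
  have hcn := ce_conn hK' hA hXY hmax
  obtain ⟨hAO, hAX, hAY, hSO, hXS, hYS, hAS, hc, hn⟩ := hA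
  dsimp only at *
  have hAK : A ∉ K := fun h => hAX (hKX A h)
  have hZY : ¬ C G (S ∩ M ∪ K) A Y := by
    refine zy2 (Set.union_subset hSO hKO) hAO (by simp [hAS, hAK]) hAY (by simp [hYS, hKY]) hn hD hM
      (Set.union_subset_union_left _ Set.inter_subset_left) ?_
    rintro n (h | h) h1 h2
    · exact h1 (.inl ⟨h, h2⟩)
    · exact h1 (.inr h)
  refine hZY (hR A hAO (hMX A hAO hAX ?_) hAX hAY (S ∩ M) Set.inter_subset_right
    (fun v h => hSO h.1) (fun h => hXS h.1) (fun h => hYS h.1) (fun h => hAS h.1) hZX)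
  -- A in MX
  have hSub : S ⊆ Obs \ {A, X} := by
    intro v hv
    refine ⟨hSO hv, ?_⟩
    rintro (rfl | rfl)
    · exact hAS hv
    · exact hXS hv
  by_cases hX : ∃ D ∈ Obs, D ∉ S ∧ D ≠ A ∧ D ≠ X ∧ D ≠ Y ∧ G.reach D X
  · rcases hK with ⟨rfl, hXs, hp0⟩ | rfl
    swap
    · obtain ⟨D, h1, h2, h3, h4, h5, h6⟩ := hX
      exact absurd h6 (hD D h1 (by simp [h2, h4]) h3 h5 X (by simp))
    rw [Set.union_empty] at *
    let DD : Set V := {D | D ∈ Obs ∧ D ∉ S ∧ D ≠ A ∧ D ≠ X ∧ D ≠ Y}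
    obtain ⟨D0, h1, h2, h3, h4, h5, h6⟩ := hX
    obtain ⟨D, ⟨hDD, hDX⟩, hmin⟩ := Set.exists_min_image {D | D ∈ DD ∧ G.reach D X}
      (fun D => {w | w ∈ DD ∧ G.reach w D}.ncard) (Set.toFinite _) ⟨D0, ⟨h1, h2, h3, h4, h5⟩, h6⟩
    have hback : ∀ w ∈ DD, G.reach w D → G.reach D w := by
      intro w hw hr
      by_contra hnr
      have h7 := hmin w ⟨hw, hr.trans hDX⟩
      have h8 : {u | u ∈ DD ∧ G.reach u w}.ncard < {u | u ∈ DD ∧ G.reach u D}.ncard := by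
        refine Set.ncard_lt_ncard ?_ (Set.toFinite _)
        rw [Set.ssubset_iff_exists]
        refine ⟨fun u hu => ⟨hu.1, hu.2.trans hr⟩, D, ⟨hDD, Relation.ReflTransGen.refl⟩, fun h => hnr h.2⟩
      omega
    have hS2 : S ⊆ Obs \ {A, X, Y} := by
      intro v hv
      refine ⟨hSO hv, ?_⟩
      rintro (rfl | rfl | rfl)
      · exact hAS hv
      · exact hXS hv
      · exact hYS hv
    have hDDm : ∀ w ∈ Obs \ {A, X, Y}, w ∉ S → w ∈ DD := by
      intro w hw hwS
      simp only [Set.mem_sdiff, Set.mem_insert_iff, Set.mem_singleton_iff, not_or] at hw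
      exact ⟨hw.1, hwS, hw.2⟩
    have hP : ∀ v, (v ∈ S ∨ v = A ∨ v = Y) → Pu G S (Obs \ {A, X, Y}) v := by
      intro v hv w hw hw' hr
      obtain ⟨g1, g2, g3, g4, g5⟩ := hDDm w hw hw'
      exact absurd hr (hD w g1 g2 g3 g5 v hv)
    have hPD : Pu G S (Obs \ {A, X, Y}) D := fun w hw hw' hr => hback w (hDDm w hw hw') hr
    obtain ⟨c1, c2⟩ := hcn D hDD.1 hDD.2.1 hDD.2.2.1 hDD.2.2.2.1 hDD.2.2.2.2
    have c3 := C_up hS2 (fun s hs => hP s (.inl hs)) (hP A (by simp)) hPD c1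
    have c4 := C_up hS2 (fun s hs => hP s (.inl hs)) hPD (hP Y (by simp)) c2
    have hDm : D ∈ Obs \ {A, X, Y} := by
      refine ⟨hDD.1, ?_⟩
      rintro (e | e | e)
      exacts [hDD.2.2.1 e, hDD.2.2.2.1 e, hDD.2.2.2.2 e]
    have c5 := CC_trans c3 hDm c4
    have c6 := hp0 (Obs \ {A, X, Y}) Set.sdiff_subset (by simp) (by simp)
    have hP2 : ∀ v, Pu G (Obs \ {A, X, Y}) (Obs \ {A, X}) v := by
      intro v w hw hw' hr
      have : w = Y := by
        by_contra hne
        refine hw' ⟨hw.1, ?_⟩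
        rintro (e | e | e)
        exacts [hw.2 (.inl e), hw.2 (.inr e), hne e]
      subst this
      have := sink_reach hY hr
      subst this
      exact hr
    have hsub : Obs \ {A, X, Y} ⊆ Obs \ {A, X} := by
      rintro w ⟨hw, hw'⟩
      refine ⟨hw, ?_⟩
      rintro (e | e)
      exacts [hw' (.inl e), hw' (.inr (.inl e))]
    have c7 := C_up hsub (fun s _ => hP2 s) (hP2 _) (hP2 _) c5
    have c8 := C_up hsub (fun s _ => hP2 s) (hP2 _) (hP2 _) c6
    refine CC_trans c7 ⟨hYO, ?_⟩ (CC_symm c8)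
    rintro (e | e)
    exacts [hAY e.symm, hXY e.symm]
  · push Not at hX
    have hP : ∀ v, (v ∈ S ∨ v = A ∨ v = X) → Pu G S (Obs \ {A, X}) v := by
      intro v hv w hw hw' hr
      simp only [Set.mem_sdiff, Set.mem_insert_iff, Set.mem_singleton_iff, not_or] at hw
      by_cases hwY : w = Y
      · subst hwY
        have := sink_reach hY hr
        subst this
        exact hr
      · exfalso
        rcases hv with hv | hv | rfl
        · exact hD w hw.1 (by rintro (h | h); exacts [hw' h, hw.2.2 (hKX _ h)]) hw.2.1 hwY v
            (.inl (.inl hv)) hr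
        · exact hD w hw.1 (by rintro (h | h); exacts [hw' h, hw.2.2 (hKX _ h)]) hw.2.1 hwY v
            (.inr (.inl hv)) hr
        · exact hX w hw.1 hw' hw.2.1 hw.2.2 hwY hr
    exact C_up hSub (fun s hs => hP s (.inl hs)) (hP A (by simp)) (hP X (by simp)) hc

lemma transfer {V' : Type} {G' : DiGraph V'} (f : V → V') {Obs : Set V} (okS : Set V → Prop) {X Y : V}
    (hY : ∀ v, ¬ G.Edge Y v)
    (h1 : ∀ S ⊆ Obs, ∀ a b, T G S a b → T G' (f '' S) (f a) (f b))
    (h2 : ∀ S ⊆ Obs, ∀ a b, T G' (f '' S) (f a) (f b) →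
      T G S a b ∨ (b = Y ∧ T G S a X ∧ okS S) ∨ (a = Y ∧ T G S X b ∧ okS S))
    (hok : ∀ S, okS S → okS (S \ {Y}))
    (hP : ∀ S ⊆ Obs, Y ∉ S → okS S → ∀ A ∈ Obs, A ≠ Y → A ∉ S → C G S A X → C G S A Y) :
    ∀ A ∈ Obs, ∀ B ∈ Obs, A ≠ B → ∀ S ⊆ Obs, A ∉ S → B ∉ S →
      (C G S A B ↔ C G' (f '' S) (f A) (f B)) := by
  intro A hA B hB hAB S hS hAS hBS
  constructor
  · intro h
    clear hAB hAS hBS hA hB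
    induction h with
    | base h => exact .base (h1 S hS _ _ h)
    | cons h hs _ ih => exact .cons (h1 S hS _ _ h) ⟨_, hs, rfl⟩ ih
  intro h
  set S0 := S \ {Y} with hS0
  have hSS : S0 ⊆ S := Set.sdiff_subset
  have hYS0 : Y ∉ S0 := by simp [hS0]
  have hS0O : S0 ⊆ Obs := hSS.trans hS
  have hup : ∀ a b, C G S0 a b → C G S a b := by
    have hPu : ∀ v, Pu G S0 S v := by
      intro v w hw hw' hr
      have : w = Y := by
        by_contra hne; exact hw' ⟨hw, hne⟩
      subst this
      have := sink_reach hY hr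
      subst this
      exact hr
    intro a b h
    exact C_up hSS (fun s _ => hPu s) (hPu _) (hPu _) h
  let F : V → Prop := fun c => (okS S0 ∧ C G S0 c X) ∨ C G S0 c Y
  have Fcons : ∀ c s, T G S c s → s ∈ S0 → F s → F c := by
    intro c s ht hs hF
    rcases hF with ⟨h, h'⟩ | h
    · exact .inl ⟨h, .cons (T_anti hSS ht) hs h'⟩
    · exact .inr (.cons (T_anti hSS ht) hs h)
  have Ftrans : ∀ c s, C G S0 c s → s ∈ S0 → F s → F c := by
    intro c s ht hs hF
    rcases hF with ⟨h, h'⟩ | h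
    · exact .inl ⟨h, CC_trans ht hs h'⟩
    · exact .inr (CC_trans ht hs h)
  have FP : ∀ c ∈ Obs, c ≠ Y → c ∉ S → F c → C G S0 c Y := by
    intro c hc hcY hcS hF
    rcases hF with ⟨h, h'⟩ | h
    · exact hP S0 hS0O hYS0 h c hc hcY (fun h => hcS (hSS h)) h'
    · exact h
  -- to Y
  have toY : ∀ x y, C G' (f '' S) x y → ∀ c, x = f c → y = f Y → c ≠ Y → F c := by
    intro x y h
    induction h with
    | base h =>
      rintro c rfl rfl hcY
      rcases h2 S hS _ _ h with h | ⟨-, h, h'⟩ | ⟨h, -⟩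
      · exact .inr (.base (T_anti hSS h))
      · exact .inl ⟨hok _ h', .base (T_anti hSS h)⟩
      · exact absurd h hcY
    | cons h hs _ ih =>
      obtain ⟨s, hs, rfl⟩ := hs
      rintro c rfl rfl hcY
      by_cases hsY : s = Y
      · subst hsY
        rcases h2 S hS _ _ h with h | ⟨-, h, h'⟩ | ⟨h, -⟩
        · exact .inr (.base (T_anti hSS h))
        · exact .inl ⟨hok _ h', .base (T_anti hSS h)⟩
        · exact absurd h hcY
      · rcases h2 S hS _ _ h with h | ⟨h, -⟩ | ⟨h, -⟩
        · exact Fcons _ _ h ⟨hs, hsY⟩ (ih s rfl rfl hsY)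
        · exact absurd h hsY
        · exact absurd h hcY
  have gen : ∀ x y, C G' (f '' S) x y → ∀ c b, x = f c → y = f b → b ≠ Y →
      (c = Y → F b) ∧ (c ≠ Y → C G S0 c b ∨ (F c ∧ F b)) := by
    intro x y h
    induction h with
    | base h =>
      rintro c b rfl rfl hbY
      rcases h2 S hS _ _ h with h | ⟨h, -⟩ | ⟨h0, h, h'⟩
      · refine ⟨?_, fun _ => .inl (.base (T_anti hSS h))⟩
        rintro rfl
        exact .inr (.base (T_symm (T_anti hSS h)))
      · exact absurd h hbY
      · exact ⟨fun _ => .inl ⟨hok _ h', .base (T_symm (T_anti hSS h))⟩, fun h => absurd h0 h⟩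
    | cons h hs _ ih =>
      obtain ⟨s, hs, rfl⟩ := hs
      rintro c b rfl rfl hbY
      obtain ⟨ih1, ih2⟩ := ih s b rfl rfl hbY
      by_cases hsY : s = Y
      · subst hsY
        refine ⟨fun _ => ih1 rfl, fun hcY => .inr ⟨?_, ih1 rfl⟩⟩
        rcases h2 S hS _ _ h with h | ⟨-, h, h'⟩ | ⟨h, -⟩
        · exact .inr (.base (T_anti hSS h))
        · exact .inl ⟨hok _ h', .base (T_anti hSS h)⟩
        · exact absurd h hcY
      · have hs0 : s ∈ S0 := ⟨hs, hsY⟩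
        constructor
        · rintro rfl
          have Fs : F s := by
            rcases h2 S hS _ _ h with h | ⟨h, -⟩ | ⟨-, h, h'⟩
            · exact .inr (.base (T_symm (T_anti hSS h)))
            · exact absurd h hsY
            · exact .inl ⟨hok _ h', .base (T_symm (T_anti hSS h))⟩
          rcases ih2 hsY with h | h
          · exact Ftrans _ _ (CC_symm h) hs0 Fs
          · exact h.2
        · intro hcY
          rcases h2 S hS _ _ h with h | ⟨h, -⟩ | ⟨h, -⟩
          · rcases ih2 hsY with h' | h'
            · exact .inl (.cons (T_anti hSS h) hs0 h')
            · exact .inr ⟨Fcons _ _ h hs0 h'.1, h'.2⟩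
          · exact absurd h hsY
          · exact absurd h hcY
  by_cases hBY : B = Y
  · subst hBY
    exact hup _ _ (FP A hA hAB hAS (toY _ _ h A rfl rfl hAB))
  by_cases hAY : A = Y
  · subst hAY
    exact CC_symm (hup _ _ (FP B hB hBY hBS (toY _ _ (CC_symm h) B rfl rfl hBY)))
  rcases (gen _ _ h A B rfl rfl hBY).2 hAY with h' | ⟨hFA, hFB⟩
  · exact hup _ _ h'
  · have hA' := FP A hA hAY hAS hFA
    have hB' := FP B hB hBY hBS hFB
    by_cases hYS : Y ∈ S
    · exact CC_trans (hup _ _ hA') hYS (CC_symm (hup _ _ hB'))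
    · -- Y not in S: no use of Y
      have hno : ∀ x y, C G' (f '' S) x y → ∀ c b, x = f c → y = f b → c ≠ Y → b ≠ Y →
          C G S c b := by
        intro x y h
        induction h with
        | base h =>
          rintro c b rfl rfl hcY hbY
          rcases h2 S hS _ _ h with h | ⟨h, -⟩ | ⟨h, -⟩
          · exact .base h
          · exact absurd h hbY
          · exact absurd h hcY
        | cons h hs _ ih =>
          obtain ⟨s, hs, rfl⟩ := hs
          rintro c b rfl rfl hcY hbY
          have hsY : s ≠ Y := fun e => hYS (e ▸ hs)
          rcases h2 S hS _ _ h with h | ⟨h, -⟩ | ⟨h, -⟩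
          · exact .cons h hs (ih s b rfl rfl hsY hbY)
          · exact absurd h hsY
          · exact absurd h hcY
      exact hno _ _ h A B rfl rfl hAY hBY

lemma conn_of_path {A B : V} {S : Set V} (hA : A ∉ S) (hB : B ∉ S) (p : GPath G A B)
    (hp : ¬ p.sigmaBlocked S) : C G S A B := by
  have hok : ∀ i : Fin (p.k + 1), (p.dir i = true → ok G S (p.node i.castSucc) (p.node i.succ)) ∧
      (p.dir i = false → ok G S (p.node i.succ) (p.node i.castSucc)) := by
    intro i
    refine ⟨fun hd => ⟨(p.adj i).1 hd, fun hs => ?_⟩, fun hd => ⟨(p.adj i).2 hd, fun hs => ?_⟩⟩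
    · by_contra hsc
      induction i using Fin.cases with
      | zero => rw [Fin.castSucc_zero, p.first] at hs; exact hA hs
      | succ j =>
        refine hp ⟨j, .inr ⟨fun h => ?_, hs, .inl ⟨hd, hsc⟩⟩⟩
        rw [h.2] at hd; exact absurd hd (by simp)
    · by_contra hsc
      induction i using Fin.lastCases with
      | last => rw [Fin.succ_last, p.last] at hs; exact hB hs
      | cast j =>
        refine hp ⟨j, .inr ⟨fun h => ?_, hs, .inr ⟨hd, hsc⟩⟩⟩
        rw [h.1] at hd; exact absurd hd (by simp)
  let J : V → Prop := fun v => R G S v A ∨ ∃ s ∈ S, C G S A s ∧ R G S v s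
  have JC : ∀ v u, J v → R G S v u → C G S A u := by
    rintro v u (h | ⟨s, hs, h, h'⟩) hr
    · exact .base ⟨v, h, hr⟩
    · exact CC_trans h hs (.base ⟨v, h', hr⟩)
  have JJ : ∀ v u, J v → R G S u v → J u := by
    rintro v u (h | ⟨s, hs, h, h'⟩) hr
    · exact .inl (R_trans hr h)
    · exact .inr ⟨s, hs, h, R_trans hr h'⟩
  have inv : ∀ i : Fin (p.k + 1), (p.dir i = true → C G S A (p.node i.succ)) ∧
      (p.dir i = false → J (p.node i.succ)) := by
    intro i
    induction i using Fin.induction with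
    | zero =>
      have J0 : J (p.node (Fin.castSucc 0)) := by
        rw [Fin.castSucc_zero, p.first]; exact .inl (R_refl _)
      exact ⟨fun h => JC _ _ J0 (.single ((hok 0).1 h)), fun h => JJ _ _ J0 (.single ((hok 0).2 h))⟩
    | succ j ih =>
      have e : p.node j.succ.castSucc = p.node j.castSucc.succ := by rw [Fin.succ_castSucc]
      cases hd : p.dir j.castSucc with
      | true =>
        have hc := ih.1 hd
        rw [← e] at hc
        refine ⟨fun h => CC_ext hc (.single ((hok j.succ).1 h)), fun h => ?_⟩
        have han : p.node j.succ.castSucc ∈ G.anc S := by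
          by_contra hna
          exact hp ⟨j, .inl ⟨⟨hd, h⟩, hna⟩⟩
        obtain ⟨s, hs, hr⟩ := han
        have : ∃ s ∈ S, R G S (p.node j.succ.castSucc) s := by
          rcases reach_R (S := S) hr with h | h
          · exact ⟨s, hs, h⟩
          · exact h
        obtain ⟨s, hs, hr⟩ := this
        exact .inr ⟨s, hs, CC_ext hc hr, R_trans (.single ((hok j.succ).2 h)) hr⟩
      | false =>
        have hc := ih.2 hd
        rw [← e] at hc
        exact ⟨fun h => JC _ _ hc (.single ((hok j.succ).1 h)),
          fun h => JJ _ _ hc (.single ((hok j.succ).2 h))⟩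
  have hl := inv (Fin.last p.k)
  rw [Fin.succ_last, p.last] at hl
  cases hd : p.dir (Fin.last p.k) with
  | true => exact hl.1 hd
  | false => exact JC _ _ (hl.2 hd) (R_refl _)

structure Wk (G : DiGraph V) (S : Set V) (A : V) (n : ℕ) (node : ℕ → V) (dir : ℕ → Bool) : Prop where
  first : node 0 = A
  edge1 : ∀ i < n, dir i = true → ok G S (node i) (node (i + 1))
  edge2 : ∀ i < n, dir i = false → ok G S (node (i + 1)) (node i)
  coll : ∀ i, i + 1 < n → dir i = true → dir (i + 1) = false → node (i + 1) ∈ G.anc S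

def Wd (G : DiGraph V) (S : Set V) (A : V) (v : V) (d : Bool) : Prop :=
  ∃ n node dir, Wk G S A n node dir ∧ node n = v ∧ (d = false → ∀ i, i + 1 = n → dir i = false)

lemma Wd_append {S : Set V} {A v u : V} {d : Bool} (h : Wd G S A v d) (e : Bool)
    (he1 : e = true → ok G S v u) (he2 : e = false → ok G S u v)
    (hc : e = false → d = true → v ∈ G.anc S) : Wd G S A u e := by
  obtain ⟨n, node, dir, hw, hv, hd⟩ := h
  refine ⟨n + 1, fun i => if i ≤ n then node i else u, fun i => if i < n then dir i else e,
    ⟨?_, ?_, ?_, ?_⟩, ?_, ?_⟩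
  · simp [hw.first]
  · intro i hi hdi
    by_cases hin : i < n
    · simp only [hin, if_true] at hdi
      simpa [hin.le, Nat.succ_le_of_lt hin] using hw.edge1 i hin hdi
    · have : i = n := by omega
      subst this
      simp only [lt_irrefl, if_false] at hdi
      simpa [hv] using he1 hdi
  · intro i hi hdi
    by_cases hin : i < n
    · simp only [hin, if_true] at hdi
      simpa [hin.le, Nat.succ_le_of_lt hin] using hw.edge2 i hin hdi
    · have : i = n := by omega
      subst this
      simp only [lt_irrefl, if_false] at hdi
      simpa [hv] using he2 hdi
  · intro i hi h1 h2
    have hin : i < n := by omega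
    simp only [hin, if_true] at h1
    by_cases hin' : i + 1 < n
    · simp only [hin', if_true] at h2
      simpa [hin'.le] using hw.coll i hin' h1 h2
    · have : i + 1 = n := by omega
      simp only [this, lt_irrefl, if_false] at h2
      simp only [this, le_refl, if_true, hv]
      apply hc h2
      by_contra hdt
      have := hd (by simpa using hdt) i this
      rw [this] at h1; exact absurd h1 (by simp)
  · simp
  · intro he i hi
    have : i = n := by omega
    simp [this, he]

lemma Wd_weak {S : Set V} {A v : V} {d : Bool} (h : Wd G S A v d) : Wd G S A v true := by
  obtain ⟨n, node, dir, hw, hv, hd⟩ := h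
  exact ⟨n, node, dir, hw, hv, by simp⟩

lemma Wd_T {S : Set V} {A a b : V} (h : Wd G S A a false ∨ (Wd G S A a true ∧ a ∈ G.anc S))
    (ht : T G S a b) : Wd G S A b true := by
  obtain ⟨t, h1, h2⟩ := ht
  have hb : ∀ t, R G S t a → t = a ∨ Wd G S A t false := by
    intro t h1
    induction h1 using Relation.ReflTransGen.head_induction_on with
    | refl => exact .inl rfl
    | @head u w hu _ ih =>
      right
      rcases ih with rfl | ih
      · rcases h with h | ⟨h, h'⟩
        · exact Wd_append h false (by simp) (fun _ => hu) (by simp)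
        · exact Wd_append h false (by simp) (fun _ => hu) (fun _ _ => h')
      · exact Wd_append ih false (by simp) (fun _ => hu) (by simp)
  have h3 : Wd G S A t true := by
    rcases hb t h1 with rfl | h4
    · rcases h with h | h
      · exact Wd_weak h
      · exact h.1
    · exact Wd_weak h4
  clear h1
  induction h2 with
  | refl => exact h3
  | tail _ hu ih => exact Wd_append ih true (fun _ => hu) (by simp) (by simp)

lemma Wd_C {S : Set V} {A B : V} (h : C G S A B) : Wd G S A B true := by
  have key : ∀ a b, C G S a b → (Wd G S A a false ∨ (Wd G S A a true ∧ a ∈ G.anc S)) →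
      Wd G S A b true := by
    intro a b h
    induction h with
    | base h => exact fun h0 => Wd_T h0 h
    | @cons a s b h1 h2 _ ih =>
      exact fun h0 => ih (.inr ⟨Wd_T h0 h1, s, h2, Relation.ReflTransGen.refl⟩)
  refine key A B h (.inl ⟨0, fun _ => A, fun _ => true, ⟨rfl, ?_, ?_, ?_⟩, rfl, ?_⟩) <;>
    intros <;> omega

lemma Wk_run {S : Set V} {A : V} {n : ℕ} {node : ℕ → V} {dir : ℕ → Bool}
    (hw : Wk G S A n node dir) {i : ℕ} (hi : dir i = true) :
    ∀ m, i + m < n → (dir (i + m) = true ∧ G.reach (node i) (node (i + m))) ∨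
      node i ∈ G.anc S := by
  intro m
  induction m with
  | zero => exact fun _ => .inl ⟨hi, Relation.ReflTransGen.refl⟩
  | succ m ih =>
    intro hm
    rcases ih (by omega) with ⟨h1, h2⟩ | h
    · have h3 : G.reach (node i) (node (i + m + 1)) :=
        Relation.ReflTransGen.tail h2 (hw.edge1 (i + m) (by omega) h1).1
      cases hd : dir (i + m + 1) with
      | true => exact .inl ⟨rfl, h3⟩
      | false =>
        obtain ⟨s, hs, h4⟩ := hw.coll (i + m) (by omega) h1 hd
        exact .inr ⟨s, hs, Relation.ReflTransGen.trans h3 h4⟩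
    · exact .inr h

lemma Wk_cut {S : Set V} {A : V} {n : ℕ} {node : ℕ → V} {dir : ℕ → Bool}
    (hw : Wk G S A n node dir) {i j : ℕ} (hij : i < j) (hj : j ≤ n) (he : node i = node j) :
    ∃ node' dir', Wk G S A (n - (j - i)) node' dir' ∧ node' (n - (j - i)) = node n := by
  obtain ⟨d, rfl⟩ := Nat.exists_eq_add_of_lt hij
  have ed : i + d + 1 - i = d + 1 := by omega
  rw [ed]
  let node' : ℕ → V := fun m => if m ≤ i then node m else node (m + (d + 1))
  let dir' : ℕ → Bool := fun m => if m < i then dir m else dir (m + (d + 1))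
  have n1 : ∀ m, m ≤ i → node' m = node m := fun m hm => by simp [node', hm]
  have n2 : ∀ m, i ≤ m → node' m = node (m + (d + 1)) := fun m hm => by
    rcases hm.eq_or_lt with rfl | hm
    · rw [n1 _ le_rfl, he]; rfl
    · simp [node', hm]
  have d1 : ∀ m, m < i → dir' m = dir m := fun m hm => by simp [dir', hm]
  have d2 : ∀ m, i ≤ m → dir' m = dir (m + (d + 1)) := fun m hm => by
    simp [dir', hm]
  refine ⟨node', dir', ⟨?_, ?_, ?_, ?_⟩, ?_⟩
  · rw [n1 0 (by omega), hw.first]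
  · intro m hm hd
    rcases lt_or_ge m i with h | h
    · rw [d1 m h] at hd
      rw [n1 m h.le, n1 (m + 1) h]
      exact hw.edge1 m (by omega) hd
    · rw [d2 m h] at hd
      rw [n2 m h, n2 (m + 1) (by omega), show m + 1 + (d + 1) = m + (d + 1) + 1 by omega]
      exact hw.edge1 _ (by omega) hd
  · intro m hm hd
    rcases lt_or_ge m i with h | h
    · rw [d1 m h] at hd
      rw [n1 m h.le, n1 (m + 1) h]
      exact hw.edge2 m (by omega) hd
    · rw [d2 m h] at hd
      rw [n2 m h, n2 (m + 1) (by omega), show m + 1 + (d + 1) = m + (d + 1) + 1 by omega]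
      exact hw.edge2 _ (by omega) hd
  · intro m hm h1 h2
    rcases lt_trichotomy (m + 1) i with h | h | h
    · rw [d1 m (by omega)] at h1
      rw [d1 (m + 1) h] at h2
      rw [n1 _ h.le]
      exact hw.coll m (by omega) h1 h2
    · rw [d1 m (by omega)] at h1
      rw [d2 (m + 1) (by omega), h] at h2
      rw [n1 _ h.le, h]
      cases hdi : dir i with
      | false =>
        have := hw.coll m (by omega) h1 (by rw [h]; exact hdi)
        rwa [h] at this
      | true =>
        rcases Wk_run hw hdi d (by omega) with ⟨h3, _⟩ | h3
        · have := hw.coll (i + d) (by omega) h3 h2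
          rwa [← he] at this
        · exact h3
    · rw [d2 m (by omega)] at h1
      rw [d2 (m + 1) (by omega), show m + 1 + (d + 1) = m + (d + 1) + 1 by omega] at h2
      rw [n2 _ (by omega), show m + 1 + (d + 1) = m + (d + 1) + 1 by omega]
      exact hw.coll _ (by omega) h1 h2
  · rw [n2 _ (by omega)]
    congr 1
    omega

lemma path_of_conn {S : Set V} {A B : V} (hAB : A ≠ B) (h : C G S A B) :
    ∃ p : GPath G A B, ¬ p.sigmaBlocked S := by
  classical
  have hex : ∃ n, ∃ node dir, Wk G S A n node dir ∧ node n = B := by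
    obtain ⟨n, node, dir, h1, h2, _⟩ := Wd_C h
    exact ⟨n, node, dir, h1, h2⟩
  have hmin := fun m => Nat.find_min hex (m := m)
  obtain ⟨node, dir, hw, hB⟩ := Nat.find_spec hex
  generalize Nat.find hex = n at *
  have hinj : ∀ i j, i < j → j ≤ n → node i ≠ node j := by
    intro i j hij hj he
    obtain ⟨node', dir', h1, h2⟩ := Wk_cut hw hij hj he
    exact hmin (n - (j - i)) (by omega) ⟨node', dir', h1, h2.trans hB⟩
  have hn : n ≠ 0 := by
    rintro rfl
    exact hAB (hw.first.symm.trans hB)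
  obtain ⟨k, rfl⟩ := Nat.exists_eq_succ_of_ne_zero hn
  refine ⟨⟨k, fun i => node i, fun i => dir i, ?_, ?_, ?_, ?_⟩, ?_⟩
  · intro a b hab
    rcases lt_trichotomy a.1 b.1 with h | h | h
    · exact absurd hab (hinj _ _ h (by omega))
    · exact Fin.ext h
    · exact absurd hab.symm (hinj _ _ h (by omega))
  · simpa using hw.first
  · simpa using hB
  · intro i
    exact ⟨fun hd => by simpa using (hw.edge1 i i.2 hd).1, fun hd => by simpa using (hw.edge2 i i.2 hd).1⟩
  · rintro ⟨j, ⟨⟨h1, h2⟩, h3⟩ | ⟨_, h2, ⟨h3, h4⟩ | ⟨h3, h4⟩⟩⟩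
    · exact h3 (hw.coll j (by have : (j : ℕ) < k := j.2; omega) h1 h2)
    · exact h4 ((hw.edge1 (j + 1) (by have : (j : ℕ) < k := j.2; omega) h3).2 h2)
    · exact h4 ((hw.edge2 j (by have : (j : ℕ) < k := j.2; omega) h3).2 h2)

lemma sep_iff {S : Set V} {A B : V} (hAB : A ≠ B) (hA : A ∉ S) (hB : B ∉ S) :
    G.sigmaSep A B S ↔ ¬ C G S A B := by
  constructor
  · intro h hc
    obtain ⟨p, hp⟩ := path_of_conn hAB hc
    exact hp (h p)
  · intro h p
    by_contra hp
    exact h (conn_of_path hA hB p hp)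

lemma mb_mem {Obs M : Set V} {Y : V} (h : G.IsSigmaMB Obs Y M) :
    ∀ s ∈ Obs, s ≠ Y → C G (Obs \ {s, Y}) s Y → s ∈ M := by
  intro s hs hsY hc
  by_contra hsM
  have hn : ∀ w ∈ Obs, w ∉ M → w ≠ Y → ¬ C G M w Y := by
    intro w hw hwM hwY hc
    have := h.2.1 w ⟨hw, by simp [hwM, hwY]⟩
    rw [sep_iff (Ne.symm hwY) (fun hm => (h.1 hm).2 rfl) hwM] at this
    exact this (CC_symm hc)
  have hsub : M ⊆ Obs \ {s, Y} := by
    intro w hw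
    refine ⟨(h.1 hw).1, ?_⟩
    rintro (rfl | rfl)
    · exact hsM hw
    · exact (h.1 hw).2 rfl
  rcases C_comp hsub hc with hc | ⟨n, hn', hc⟩
  · exact hn s hs hsM hsY hc
  · refine hn n hn'.1.1 hn'.2 (fun e => hn'.1.2 (.inr e)) hc

def addE (G : DiGraph V) (X Y : V) (h : X ≠ Y) : DiGraph V where
  Edge u v := G.Edge u v ∨ (u = X ∧ v = Y)
  loopless v := by
    rintro (h1 | ⟨rfl, h2⟩)
    · exact G.loopless v h1
    · exact h h2

section addE
variable {X Y : V} {h : X ≠ Y}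

lemma addE_mono {u v : V} (hr : G.reach u v) : (addE G X Y h).reach u v :=
  Relation.ReflTransGen.mono (r := G.Edge) (p := (addE G X Y h).Edge) (fun _ _ h => .inl h) _ _ hr

lemma addE_R {S : Set V} {u v : V} (hr : R G S u v) : R (addE G X Y h) S u v :=
  Relation.ReflTransGen.mono (r := ok G S) (p := ok (addE G X Y h) S)
    (fun _ _ h => ⟨.inl h.1, fun hs => ⟨addE_mono (h.2 hs).1, addE_mono (h.2 hs).2⟩⟩) _ _ hr

lemma addE_reach (hY : ∀ v, ¬ G.Edge Y v) {u v : V} (hr : (addE G X Y h).reach u v) :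
    G.reach u v ∨ (v = Y ∧ G.reach u X) := by
  induction hr with
  | refl => exact .inl Relation.ReflTransGen.refl
  | tail _ he ih =>
    rcases ih with ih | ⟨rfl, ih⟩
    · rcases he with he | ⟨rfl, rfl⟩
      · exact .inl (Relation.ReflTransGen.tail ih he)
      · exact .inr ⟨rfl, ih⟩
    · rcases he with he | ⟨rfl, rfl⟩
      · exact absurd he (hY _)
      · exact absurd rfl h

lemma addE_scc (hY : ∀ v, ¬ G.Edge Y v) {u v : V} (hr : v ∈ (addE G X Y h).scc u) :
    v ∈ G.scc u := by
  have hY' : ∀ w, G.reach Y w → w = Y := fun w hw => sink_reach hY hw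
  rcases addE_reach hY hr.1 with h1 | ⟨rfl, h1⟩
  · rcases addE_reach hY hr.2 with h2 | ⟨rfl, h2⟩
    · exact ⟨h1, h2⟩
    · obtain rfl := hY' _ h1
      exact ⟨h1, h1⟩
  · rcases addE_reach hY hr.2 with h2 | ⟨_, h2⟩
    · obtain rfl := hY' _ h2
      exact ⟨h2, h2⟩
    · exact absurd (hY' _ h2) h

lemma addE_R' (hY : ∀ v, ¬ G.Edge Y v) {S : Set V} {u v : V} (hr : R (addE G X Y h) S u v) :
    R G S u v ∨ (X ∉ S ∧ v = Y ∧ R G S u X) := by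
  induction hr with
  | refl => exact .inl (R_refl _)
  | tail _ he ih =>
    rcases ih with ih | ⟨_, rfl, ih⟩
    · obtain ⟨he | ⟨rfl, rfl⟩, hs⟩ := he
      · exact .inl (Relation.ReflTransGen.tail ih ⟨he, fun h => addE_scc hY (hs h)⟩)
      · refine .inr ⟨fun hX => ?_, rfl, ih⟩
        exact h (sink_reach hY (addE_scc hY (hs hX)).2)
    · rcases he.1 with he | ⟨rfl, rfl⟩
      · exact absurd he (hY _)
      · exact absurd rfl h

lemma addE_T (hY : ∀ v, ¬ G.Edge Y v) {S : Set V} {a b : V} (hr : T (addE G X Y h) S a b) :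
    T G S a b ∨ (b = Y ∧ T G S a X ∧ X ∉ S) ∨ (a = Y ∧ T G S X b ∧ X ∉ S) := by
  obtain ⟨t, h1, h2⟩ := hr
  rcases addE_R' hY h1 with h3 | ⟨hX, e, h3⟩
  · rcases addE_R' hY h2 with h4 | ⟨hX, e', h4⟩
    · exact .inl ⟨t, h3, h4⟩
    · exact .inr (.inl ⟨e', ⟨t, h3, h4⟩, hX⟩)
  · rcases addE_R' hY h2 with h4 | ⟨hX, e', h4⟩
    · exact .inr (.inr ⟨e, ⟨t, h3, h4⟩, hX⟩)
    · rw [e, e']; exact .inl (T_refl _)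

end addE

/-- Remove the edge `X → Y`, replace it by a latent common cause and make the parents of `X`
parents of `Y`. -/
def remE (G : DiGraph V) (X Y : V) (hYX : ¬ G.Edge Y X) : DiGraph (Option V) where
  Edge
    | some u, some v => (G.Edge u v ∧ ¬ (u = X ∧ v = Y)) ∨ (v = Y ∧ G.Edge u X)
    | none, some v => v = X ∨ v = Y
    | _, none => False
  loopless v := by
    cases v with
    | none => simp
    | some v =>
      rintro (h1 | ⟨rfl, h2⟩)
      · exact G.loopless v h1.1
      · exact hYX h2

section remE
variable {X Y : V} {h : ¬ G.Edge Y X}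

lemma remE_none {z : Option V} (hr : (remE G X Y h).reach z none) : z = none := by
  cases hr with
  | refl => rfl
  | @tail b _ _ he => cases b <;> exact absurd he (by simp [remE])

lemma rem_X (hX : ∀ v, G.Edge X v → v = Y) (hY : ∀ v, ¬ G.Edge Y v) {v : V} (hr : G.reach X v) :
    v = X ∨ v = Y := by
  induction hr with
  | refl => exact .inl rfl
  | tail _ he ih =>
    rcases ih with rfl | rfl
    · exact .inr (hX _ he)
    · exact absurd he (hY _)

lemma remE_mono (hX : ∀ v, G.Edge X v → v = Y) (hY : ∀ v, ¬ G.Edge Y v) {u v : V}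
    (hr : G.reach u v) : (remE G X Y h).reach (some u) (some v) ∨ u = X := by
  induction hr using Relation.ReflTransGen.head_induction_on with
  | refl => exact .inl Relation.ReflTransGen.refl
  | @head u w he h1 ih =>
    by_cases hu : u = X
    · exact .inr hu
    left
    rcases ih with ih | rfl
    · exact Relation.ReflTransGen.head (b := some w) (.inl ⟨he, fun h => hu h.1⟩) ih
    · rcases rem_X hX hY h1 with rfl | rfl
      · exact Relation.ReflTransGen.single (.inl ⟨he, fun h => hu h.1⟩)
      · exact Relation.ReflTransGen.single (.inr ⟨rfl, he⟩)

lemma remE_ok (hX : ∀ v, G.Edge X v → v = Y) (hY : ∀ v, ¬ G.Edge Y v) {S : Set V} {u w : V}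
    (hu : u ≠ X) (he : ok G S u w) : ok (remE G X Y h) (some '' S) (some u) (some w) := by
  refine ⟨.inl ⟨he.1, fun h => hu h.1⟩, fun hs => ?_⟩
  have hs : u ∈ S := by simpa using hs
  obtain ⟨h1, h2⟩ := he.2 hs
  refine ⟨(remE_mono hX hY h1).resolve_right hu, (remE_mono hX hY h2).resolve_right ?_⟩
  rintro rfl
  rcases rem_X hX hY h2 with rfl | rfl
  · exact hu rfl
  · exact hY _ he.1

lemma remE_R (hX : ∀ v, G.Edge X v → v = Y) (hY : ∀ v, ¬ G.Edge Y v) {S : Set V} {u v : V}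
    (hr : R G S u v) : R (remE G X Y h) (some '' S) (some u) (some v) ∨ u = X := by
  induction hr using Relation.ReflTransGen.head_induction_on with
  | refl => exact .inl (R_refl _)
  | @head u w he h1 ih =>
    by_cases hu : u = X
    · exact .inr hu
    left
    rcases ih with ih | rfl
    · exact Relation.ReflTransGen.head (b := some w) (remE_ok hX hY hu he) ih
    · rcases rem_X hX hY (R_reach h1) with rfl | rfl
      · exact Relation.ReflTransGen.single (remE_ok hX hY hu he)
      · refine Relation.ReflTransGen.single ⟨.inr ⟨rfl, he.1⟩, fun hs => ?_⟩
        have hs : u ∈ S := by simpa using hs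
        rcases rem_X hX hY (he.2 hs).2 with rfl | rfl
        · exact absurd rfl hu
        · exact absurd he.1 (hY _)

lemma remE_T1 (hX : ∀ v, G.Edge X v → v = Y) (hY : ∀ v, ¬ G.Edge Y v) {S : Set V} {a b : V}
    (hr : T G S a b) : T (remE G X Y h) (some '' S) (some a) (some b) := by
  obtain ⟨t, h1, h2⟩ := hr
  by_cases ht : t = X
  · subst ht
    have hn : ∀ v, R G S t v → R (remE G t Y h) (some '' S) none (some v) := by
      intro v hv
      exact Relation.ReflTransGen.single ⟨rem_X hX hY (R_reach hv), fun hs => by simp at hs⟩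
    exact ⟨none, hn _ h1, hn _ h2⟩
  · exact ⟨some t, (remE_R hX hY h1).resolve_right ht, (remE_R hX hY h2).resolve_right ht⟩

lemma remE_reach (hXY : G.Edge X Y) {u : V} {z : Option V}
    (hr : (remE G X Y h).reach (some u) z) : ∀ v, z = some v → G.reach u v := by
  induction hr with
  | refl => rintro v hv; cases hv; exact Relation.ReflTransGen.refl
  | @tail b c h1 he ih =>
    rintro v rfl
    cases b with
    | none => exact absurd (remE_none h1) (by simp)
    | some w =>
      have ih := ih w rfl
      rcases he with he | ⟨rfl, he⟩
      · exact Relation.ReflTransGen.tail ih he.1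
      · exact Relation.ReflTransGen.tail (Relation.ReflTransGen.tail ih he) hXY

lemma remE_R' (hXY : G.Edge X Y) (hY : ∀ v, ¬ G.Edge Y v) {S : Set V} {u : V} {z : Option V}
    (hr : R (remE G X Y h) (some '' S) (some u) z) :
    ∀ v, z = some v → R G S u v ∨ (v = Y ∧ R G S u X) := by
  induction hr with
  | refl => rintro v hv; cases hv; exact .inl (R_refl _)
  | @tail b c h1 he ih =>
    rintro v rfl
    cases b with
    | none => exact absurd (remE_none (R_reach h1)) (by simp)
    | some w =>
      obtain ⟨he, hs⟩ := he
      have hs' : w ∈ S → v ∈ G.scc w := fun hw => by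
        have := hs ⟨w, hw, rfl⟩
        exact ⟨remE_reach hXY this.1 _ rfl, remE_reach hXY this.2 _ rfl⟩
      rcases ih w rfl with ih' | ⟨rfl, ih'⟩
      · rcases he with he | ⟨rfl, he⟩
        · exact .inl (Relation.ReflTransGen.tail ih' ⟨he.1, hs'⟩)
        · refine .inr ⟨rfl, Relation.ReflTransGen.tail ih' ⟨he, fun hw => ?_⟩⟩
          have := sink_reach hY (hs' hw).2
          subst this
          exact absurd he h
      · rcases he with he | ⟨rfl, he⟩
        · exact absurd he.1 (hY _)
        · exact absurd he h

lemma remE_Rn (hY : ∀ v, ¬ G.Edge Y v) (hX : ∀ v, G.Edge X v → v = Y) {z : Option V}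
    (hr : (remE G X Y h).reach none z) :
    ∀ v, z = some v → v = X ∨ v = Y := by
  induction hr with
  | refl => rintro v hv; cases hv
  | @tail b c h1 he ih =>
    rintro v rfl
    cases b with
    | none => exact he
    | some w =>
      rcases ih w rfl with rfl | rfl
      · rcases he with he | ⟨rfl, he⟩
        · exact .inr (hX _ he.1)
        · exact .inr rfl
      · rcases he with he | ⟨rfl, he⟩
        · exact absurd he.1 (hY _)
        · exact .inr rfl

lemma remE_T2 (hXY : G.Edge X Y) (hX : ∀ v, G.Edge X v → v = Y) (hY : ∀ v, ¬ G.Edge Y v)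
    {S : Set V} {a b : V} (hr : T (remE G X Y h) (some '' S) (some a) (some b)) :
    T G S a b ∨ (b = Y ∧ T G S a X ∧ True) ∨ (a = Y ∧ T G S X b ∧ True) := by
  obtain ⟨t, h1, h2⟩ := hr
  cases t with
  | none =>
    rcases remE_Rn hY hX (R_reach h1) _ rfl with rfl | rfl <;>
    rcases remE_Rn hY hX (R_reach h2) _ rfl with rfl | rfl
    · exact .inl (T_refl _)
    · exact .inr (.inl ⟨rfl, T_refl _, trivial⟩)
    · exact .inr (.inr ⟨rfl, T_refl _, trivial⟩)
    · exact .inl (T_refl _)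
  | some t =>
    rcases remE_R' hXY hY h1 _ rfl with h3 | ⟨e, h3⟩
    · rcases remE_R' hXY hY h2 _ rfl with h4 | ⟨e', h4⟩
      · exact .inl ⟨t, h3, h4⟩
      · exact .inr (.inl ⟨e', ⟨t, h3, h4⟩, trivial⟩)
    · rcases remE_R' hXY hY h2 _ rfl with h4 | ⟨e', h4⟩
      · exact .inr (.inr ⟨e, ⟨t, h3, h4⟩, trivial⟩)
      · rw [e, e']; exact .inl (T_refl _)

end remE

lemma pre_Y {X Y : V} (h : PreTreatment G X Y) : ∀ v, ¬ G.Edge Y v := by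
  intro v hv
  have : v ∈ G.de Y := ⟨fun e => G.loopless Y (e ▸ hv), Relation.TransGen.single hv⟩
  rw [h.1] at this
  exact this

lemma pre_mk {X Y : V} (h1 : ∀ v, ¬ G.Edge Y v) (h2 : ∀ v, G.Edge X v → v = Y) :
    PreTreatment G X Y := by
  refine ⟨?_, fun v hv => h2 v hv⟩
  ext v
  simp only [Set.mem_empty_iff_false, iff_false]
  rintro ⟨_, h⟩
  obtain ⟨w, hw, _⟩ := Relation.TransGen.head'_iff.1 h
  exact h1 _ hw

lemma sep_transfer {V' : Type} {G' : DiGraph V'} {f : V → V'} (hf : Function.Injective f)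
    {Obs : Set V}
    (h : ∀ A ∈ Obs, ∀ B ∈ Obs, A ≠ B → ∀ S ⊆ Obs, A ∉ S → B ∉ S →
      (C G S A B ↔ C G' (f '' S) (f A) (f B))) :
    ∀ A ∈ Obs, ∀ B ∈ Obs, A ≠ B → ∀ S ⊆ Obs \ {A, B},
        (G.sigmaSep A B S ↔ G'.sigmaSep (f A) (f B) (f '' S)) := by
  intro A hA B hB hAB S hS
  have hAS : A ∉ S := fun h => (hS h).2 (.inl rfl)
  have hBS : B ∉ S := fun h => (hS h).2 (.inr rfl)
  rw [sep_iff hAB hAS hBS, sep_iff (fun e => hAB (hf e)) (by rwa [hf.mem_set_image])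
    (by rwa [hf.mem_set_image]), h A hA B hB hAB S (fun x hx => (hS hx).1) hAS hBS]

end RC

/-- Completeness of R1 and R2 at the level of separation
information: if neither rule applies, the σ-separation relations among the
observed nodes do not determine the presence of the edge `X → Y`. -/
theorem R1_R2_complete {V : Type} [Fintype V]
    (G : DiGraph V) (Obs Lat : Set V)
    (hpart : Obs ∪ Lat = Set.univ) (hdisj : Obs ∩ Lat = ∅)
    (X Y : V) (hX : X ∈ Obs) (hY : Y ∈ Obs) (hXY : X ≠ Y)
    (hpre : PreTreatment G X Y)
    (MBX MBY : Set V)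
    (hMBX : G.IsSigmaMB Obs X MBX) (hMBY : G.IsSigmaMB Obs Y MBY)
    (hR1 : ¬ ∃ W ∈ MBX \ {Y}, ∃ Z ⊆ MBY \ {X, W},
      ¬ G.sigmaSep W Y Z ∧ G.sigmaSep W Y (Z ∪ {X}))
    (hR2 : ¬ ((∃ Z ⊆ MBY \ {X}, G.sigmaSep X Y Z) ∨
      (∃ W ∈ MBX \ {Y}, ∃ Z ⊆ MBY \ {X, W},
        ¬ G.sigmaSep W X Z ∧ G.sigmaSep W Y Z))) :
    ∃ (V₁ V₂ : Type) (_ : Finite V₁) (_ : Finite V₂)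
      (G₁ : DiGraph V₁) (G₂ : DiGraph V₂) (f₁ : V → V₁) (f₂ : V → V₂),
      Set.InjOn f₁ Obs ∧ Set.InjOn f₂ Obs ∧
      PreTreatment G₁ (f₁ X) (f₁ Y) ∧ PreTreatment G₂ (f₂ X) (f₂ Y) ∧
      (∀ A ∈ Obs, ∀ B ∈ Obs, A ≠ B → ∀ S ⊆ Obs \ {A, B},
        (G.sigmaSep A B S ↔ G₁.sigmaSep (f₁ A) (f₁ B) (f₁ '' S))) ∧
      (∀ A ∈ Obs, ∀ B ∈ Obs, A ≠ B → ∀ S ⊆ Obs \ {A, B},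
        (G.sigmaSep A B S ↔ G₂.sigmaSep (f₂ A) (f₂ B) (f₂ '' S))) ∧
      G₁.Edge (f₁ X) (f₁ Y) ∧ ¬ G₂.Edge (f₂ X) (f₂ Y) := by
  have eY := RC.pre_Y hpre
  have eX : ∀ v, G.Edge X v → v = Y := fun v hv => hpre.2 hv
  have mY := RC.mb_mem hMBY
  have mX := RC.mb_mem hMBX
  have hid : ∀ A ∈ Obs, ∀ B ∈ Obs, A ≠ B → ∀ S ⊆ Obs \ {A, B},
      (G.sigmaSep A B S ↔ G.sigmaSep (id A) (id B) (id '' S)) := by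
    intro A _ B _ _ S _
    rw [Set.image_id, id, id]
  by_cases hE : G.Edge X Y
  · have hk := RC.key (G := G) (K := {X}) hX hY hXY eY (.inr rfl) mY mX (by
      intro W hWO hWM hWX hWY Z hZM hZO hXZ hYZ hWZ hc
      by_contra hn
      refine hR1 ⟨W, ⟨hWM, hWY⟩, Z, ?_, ?_, ?_⟩
      · intro z hz
        refine ⟨hZM hz, ?_⟩
        rintro (rfl | rfl)
        · exact hXZ hz
        · exact hWZ hz
      · rw [RC.sep_iff hWY hWZ hYZ, not_not]
        exact RC.CC_ext hc (.single ⟨hE, fun h => absurd h hXZ⟩)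
      · rw [RC.sep_iff hWY (by simp [hWZ, hWX]) (by simp [hYZ, hXY.symm])]
        exact hn)
    refine ⟨V, Option V, inferInstance, inferInstance, G, RC.remE G X Y (eY X), id, some,
      Function.injective_id.injOn, (Option.some_injective V).injOn, hpre, ?_, hid, ?_, hE, ?_⟩
    · refine RC.pre_mk ?_ ?_
      · rintro (_ | v) h
        · exact h
        · rcases h with h | h
          · exact eY _ h.1
          · exact eY _ h.2
      · rintro (_ | v) h
        · exact absurd h (by simp [RC.remE])
        · rcases h with h | h
          · rw [eX _ h.1]
          · rw [h.1]
    · refine RC.sep_transfer (Option.some_injective V) (RC.transfer some (fun _ => True) (X := X)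
        (Y := Y) eY (fun S _ a b h => RC.remE_T1 eX eY h)
        (fun S _ a b h => RC.remE_T2 hE eX eY h) (fun _ _ => trivial) ?_)
      intro S hSO hYS _ A hA hAY hAS hc
      by_cases hXS : X ∈ S
      · have hAX : A ≠ X := fun e => hAS (e ▸ hXS)
        have e : insert X (S \ {X}) = S := by
          rw [Set.insert_sdiff_singleton, Set.insert_eq_of_mem hXS]
        have h1 : RC.C G (S \ {X}) A X := by
          apply RC.CC_symm
          apply RC.self1
          rw [e]
          exact RC.CC_symm hc
        have := hk A hA hAX hAY (S \ {X}) (fun x hx => hSO hx.1) (fun h => h.2 rfl)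
          (fun h => hYS h.1) (fun h => hAS h.1) h1
        rwa [Set.union_singleton, e] at this
      · exact RC.CC_ext hc (.single ⟨hE, fun h => absurd h hXS⟩)
    · rintro (h | h)
      · exact h.2 ⟨rfl, rfl⟩
      · exact G.loopless _ h.2
  · have eX' : ∀ v, ¬ G.Edge X v := fun v hv => hE (eX v hv ▸ hv)
    have hp := RC.p0 (G := G) hX hXY mY (by
      intro Z hZ hZO hYZ
      by_contra hn
      refine hR2 (.inl ⟨Z, hZ, ?_⟩)
      rw [RC.sep_iff hXY (fun h => (hZ h).2 rfl) hYZ]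
      exact hn)
    have hk := RC.key (G := G) (K := ∅) hX hY hXY eY (.inl ⟨rfl, eX', hp⟩) mY mX (by
      intro W hWO hWM hWX hWY Z hZM hZO hXZ hYZ hWZ hc
      rw [Set.union_empty]
      by_contra hn
      refine hR2 (.inr ⟨W, ⟨hWM, hWY⟩, Z, ?_, ?_, ?_⟩)
      · intro z hz
        refine ⟨hZM hz, ?_⟩
        rintro (rfl | rfl)
        · exact hXZ hz
        · exact hWZ hz
      · rw [RC.sep_iff hWX hWZ hXZ, not_not]
        exact hc
      · rw [RC.sep_iff hWY hWZ hYZ]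
        exact hn)
    refine ⟨V, V, inferInstance, inferInstance, RC.addE G X Y hXY, G, id, id,
      Function.injective_id.injOn, Function.injective_id.injOn, ?_, hpre, ?_, hid,
      .inr ⟨rfl, rfl⟩, hE⟩
    · refine RC.pre_mk ?_ ?_
      · rintro v (h | h)
        · exact eY _ h
        · exact hXY h.1.symm
      · rintro v (h | h)
        · exact eX _ h
        · exact h.2
    · refine RC.sep_transfer Function.injective_id (RC.transfer id (fun S => X ∉ S) (X := X)
        (Y := Y) eY ?_ ?_ (fun S h h' => h h'.1) ?_)
      · intro S _ a b h
        rw [Set.image_id]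
        obtain ⟨t, h1, h2⟩ := h
        exact ⟨t, RC.addE_R h1, RC.addE_R h2⟩
      · intro S _ a b h
        rw [Set.image_id] at h
        exact RC.addE_T eY h
      · intro S hSO hYS hXS A hA hAY hAS hc
        by_cases hAX : A = X
        · rw [hAX]
          exact hp S hSO hXS hYS
        · have := hk A hA hAX hAY S hSO hXS hYS hAS hc
          rwa [Set.union_empty] at this
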